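/- Let 𝔹^d := {ξ ∈ ℝ^d : ‖ξ‖ ≤ 1} and let ρ_B(ξ,η) := ‖ξ−η‖ + |√(1−‖ξ‖²) − √(1−‖η‖²)| be the usual metric on 𝔹^d, with B_ρ(ξ, r) := {η ∈ 𝔹^d : ρ_B(ξ,η) ≤ r}. There exists a constant δ₀ ∈ (0,1) depending only on d with the following property: for every n ∈ ℕ, every δ ∈ (0, δ₀), and every finite set {ξ_1,…,ξ_m} ⊆ 𝔹^d that is (δ/n)-separated with respect to ρ_B (i.e. ρ_B(ξ_i, ξ_j) ≥ δ/n for i ≠ j), setting E := ∪_{j=1}^m B_ρ(ξ_j, δ/(4n)), one has ‖f‖_{L^p(𝔹^d)} ≤ C ‖f‖_{L^p(𝔹^d ∖ E)} for every 1 ≤ p < ∞ and every f ∈ Π_n^d, where C depends only on d. -/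

import Mathlib

open MeasureTheory Set
open scoped ENNReal

noncomputable section

/-- The metric `ρ_B(ξ,η) = ‖ξ−η‖ + |√(1−‖ξ‖²) − √(1−‖η‖²)|` on the unit ball `𝔹^d`. -/
def rhoBall {d : ℕ} (ξ η : EuclideanSpace ℝ (Fin d)) : ℝ :=
  dist ξ η + |Real.sqrt (1 - ‖ξ‖ ^ 2) - Real.sqrt (1 - ‖η‖ ^ 2)|

/-- The ball `B_ρ(ξ,r) = {η ∈ 𝔹^d : ρ_B(ξ,η) ≤ r}`. -/
def ballB {d : ℕ} (ξ : EuclideanSpace ℝ (Fin d)) (r : ℝ) : Set (EuclideanSpace ℝ (Fin d)) :=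
  {η | ‖η‖ ≤ 1 ∧ rhoBall ξ η ≤ r}

/-- `f` is (the evaluation of) a real polynomial in `d` variables of total degree at most `n`. -/
def IsPolyDeg {d : ℕ} (n : ℕ) (f : EuclideanSpace ℝ (Fin d) → ℝ) : Prop :=
  ∃ P : MvPolynomial (Fin d) ℝ, P.totalDegree ≤ n ∧
    ∀ x : EuclideanSpace ℝ (Fin d), f x = MvPolynomial.eval (fun i => x i) P

section Bernstein

variable {V : Type*} [NormedAddCommGroup V] [NormedSpace ℂ V]

lemma differentiable_sum_pow_smul (N : ℕ) (v : ℕ → V) :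
    Differentiable ℂ fun w : ℂ => ∑ k ∈ Finset.range (N + 1), w ^ k • v k := by
  fun_prop

lemma norm_sum_pow_smul_le_of_norm_le_one {N : ℕ} {v : ℕ → V} {M : ℝ}
    (h : ∀ w : ℂ, ‖w‖ = 1 → ‖∑ k ∈ Finset.range (N + 1), w ^ k • v k‖ ≤ M)
    {w : ℂ} (hw : ‖w‖ ≤ 1) : ‖∑ k ∈ Finset.range (N + 1), w ^ k • v k‖ ≤ M := by
  refine Complex.norm_le_of_forall_mem_frontier_norm_le (U := Metric.ball (0 : ℂ) 1)
    Metric.isBounded_ball (differentiable_sum_pow_smul N v).diffContOnCl ?_ ?_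
  · intro z hz
    rw [frontier_ball _ one_ne_zero] at hz
    exact h z (by simpa using hz)
  · rw [closure_ball _ one_ne_zero]
    simpa using hw

lemma norm_sum_pow_smul_le_of_norm_le {N : ℕ} {v : ℕ → V} {M : ℝ}
    (h : ∀ w : ℂ, ‖w‖ = 1 → ‖∑ k ∈ Finset.range (N + 1), w ^ k • v k‖ ≤ M)
    {w : ℂ} (hw : ‖w‖ ≤ 1 + 1 / N) :
    ‖∑ k ∈ Finset.range (N + 1), w ^ k • v k‖ ≤ Real.exp 1 * M := by
  have hM : 0 ≤ M := (norm_nonneg _).trans (h 1 (by simp))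
  rcases le_total ‖w‖ 1 with h1 | h1
  · refine (norm_sum_pow_smul_le_of_norm_le_one h h1).trans ?_
    exact le_mul_of_one_le_left hM (Real.one_le_exp zero_le_one)
  have hw0 : w ≠ 0 := by
    rintro rfl
    simp at h1
    linarith
  have hrev (z : ℂ) (hz : z ≠ 0) : ∑ k ∈ Finset.range (N + 1), z ^ k • v k =
      z ^ N • ∑ k ∈ Finset.range (N + 1), z⁻¹ ^ k • v (N - k) := by
    rw [← Finset.sum_range_reflect, Finset.smul_sum]
    refine Finset.sum_congr rfl fun k hk => ?_
    have hk' : k ≤ N := by simpa [Nat.lt_succ_iff] using hk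
    rw [smul_smul, inv_pow, show N + 1 - 1 - k = N - k by omega, pow_sub₀ z hz hk']
  have hr (z : ℂ) (hz : ‖z‖ = 1) :
      ‖∑ k ∈ Finset.range (N + 1), z ^ k • v (N - k)‖ ≤ M := by
    have hz0 : z⁻¹ ≠ 0 := by
      rintro h0
      simp [inv_eq_zero.1 h0] at hz
    have := h z⁻¹ (by simp [hz])
    rw [hrev _ hz0, norm_smul] at this
    simpa [hz] using this
  rw [hrev w hw0, norm_smul, norm_pow]
  have h2 := norm_sum_pow_smul_le_of_norm_le_one (v := fun k => v (N - k)) hr (w := w⁻¹)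
    (by rw [norm_inv]; exact inv_le_one_of_one_le₀ h1)
  refine mul_le_mul ?_ h2 (norm_nonneg _) (Real.exp_pos _).le
  rcases Nat.eq_zero_or_pos N with rfl | hN
  · simp
  have hN' : (0 : ℝ) < N := by exact_mod_cast hN
  calc ‖w‖ ^ N ≤ (Real.exp (1 / N)) ^ N := by
        gcongr
        refine hw.trans ?_
        linarith [Real.add_one_le_exp (1 / (N : ℝ))]
    _ = Real.exp 1 := by
        rw [← Real.exp_nat_mul]
        congr 1
        field_simp

/-- A Bernstein inequality for vector-valued polynomials on the unit circle. -/
lemma norm_sum_pow_smul_sub_le {N : ℕ} (hN : 0 < N) {v : ℕ → V} {M : ℝ}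
    (h : ∀ w : ℂ, ‖w‖ = 1 → ‖∑ k ∈ Finset.range (N + 1), w ^ k • v k‖ ≤ M)
    {w z : ℂ} (hw : ‖w‖ ≤ 1) (hz : ‖z‖ ≤ 1) :
    ‖∑ k ∈ Finset.range (N + 1), w ^ k • v k - ∑ k ∈ Finset.range (N + 1), z ^ k • v k‖
      ≤ Real.exp 1 * M * N * ‖w - z‖ := by
  have hN' : (0 : ℝ) < N := by exact_mod_cast hN
  refine Convex.norm_image_sub_le_of_norm_deriv_le (𝕜 := ℂ) (s := Metric.closedBall 0 1)
    (f := fun w : ℂ => ∑ k ∈ Finset.range (N + 1), w ^ k • v k)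
    (fun x _ => differentiable_sum_pow_smul N v x) ?_ (convex_closedBall _ _)
    (by simpa using hz) (by simpa using hw)
  intro x hx
  have hx' : ‖x‖ ≤ 1 := by simpa using hx
  have := Complex.norm_deriv_le_of_forall_mem_sphere_norm_le (c := x) (R := 1 / N)
    (C := Real.exp 1 * M) (by positivity) (differentiable_sum_pow_smul N v).diffContOnCl ?_
  · simpa using this
  · intro y hy
    refine norm_sum_pow_smul_le_of_norm_le h ?_
    have h3 : ‖y - x‖ = 1 / N := by simpa [dist_eq_norm] using hy
    calc ‖y‖ = ‖x + (y - x)‖ := by simp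
      _ ≤ ‖x‖ + ‖y - x‖ := norm_add_le _ _
      _ ≤ 1 + 1 / N := by rw [h3]; gcongr

/-- If `e^{int} u(t)` is a polynomial of degree `2 * n` in `e^{it}` and `‖u(t)‖ ≤ M` for all `t`,
then `u` is Lipschitz with constant at most `7 * n * M`. -/
lemma norm_trigPoly_sub_le {n : ℕ} (hn : 0 < n) {v : ℕ → V} {u : ℝ → V} {M : ℝ}
    (hu : ∀ t : ℝ, Complex.exp (t * Complex.I) ^ n • u t =
      ∑ k ∈ Finset.range (2 * n + 1), Complex.exp (t * Complex.I) ^ k • v k)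
    (hM : ∀ t, ‖u t‖ ≤ M) (t : ℝ) : ‖u t - u 0‖ ≤ 7 * n * M * |t| := by
  have hM0 : 0 ≤ M := (norm_nonneg _).trans (hM 0)
  have hq : ∀ w : ℂ, ‖w‖ = 1 → ‖∑ k ∈ Finset.range (2 * n + 1), w ^ k • v k‖ ≤ M := by
    intro w hw
    have hw' : Complex.exp (w.arg * Complex.I) = w := by
      simpa [hw] using Complex.norm_mul_exp_arg_mul_I w
    have := hu w.arg
    rw [hw'] at this
    rw [← this, norm_smul, norm_pow, hw, one_pow, one_mul]
    exact hM _
  have hexp : ‖Complex.exp (t * Complex.I)‖ = 1 := Complex.norm_exp_ofReal_mul_I t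
  have hd : ‖Complex.exp (t * Complex.I) - 1‖ ≤ |t| := by
    have := Real.norm_exp_I_mul_ofReal_sub_one_le (x := t)
    rwa [mul_comm, Real.norm_eq_abs] at this
  have h1 := norm_sum_pow_smul_sub_le (N := 2 * n) (by omega) hq (w := Complex.exp (t * Complex.I))
    (z := 1) hexp.le (by simp)
  have h0 := hu 0
  simp only [Complex.ofReal_zero, zero_mul, Complex.exp_zero, one_pow, one_smul] at h0
  rw [← hu t] at h1
  simp only [one_pow, one_smul] at h1
  rw [← h0] at h1
  have hpow : ‖Complex.exp (t * Complex.I) ^ n - 1‖ ≤ n * |t| := by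
    have := Real.norm_exp_I_mul_ofReal_sub_one_le (x := n * t)
    rw [Real.norm_eq_abs, abs_mul, Nat.abs_cast] at this
    rw [← Complex.exp_nat_mul]
    convert this using 4
    push_cast
    ring
  have e3 : Real.exp 1 ≤ 3 := (Real.exp_one_lt_d9.trans (by norm_num)).le
  calc ‖u t - u 0‖ = ‖Complex.exp (t * Complex.I) ^ n • (u t - u 0)‖ := by
        rw [norm_smul, norm_pow, hexp, one_pow, one_mul]
    _ = ‖(Complex.exp (t * Complex.I) ^ n • u t - u 0)
          - (Complex.exp (t * Complex.I) ^ n - 1) • u 0‖ := by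
        congr 1
        rw [smul_sub, sub_smul, one_smul]
        abel
    _ ≤ ‖Complex.exp (t * Complex.I) ^ n • u t - u 0‖
          + ‖(Complex.exp (t * Complex.I) ^ n - 1) • u 0‖ := norm_sub_le _ _
    _ ≤ 3 * M * (2 * n : ℕ) * |t| + n * |t| * M := by
        refine add_le_add (h1.trans ?_) ?_
        · gcongr
        · rw [norm_smul]
          gcongr
          exact hM 0
    _ = 7 * n * M * |t| := by
        push_cast
        ring

end Bernstein
section TrigPolynomial

variable {W : Type*} [TopologicalSpace W]

/-- `H t w` is a trigonometric polynomial of degree at most `n` in `t`, with coefficients which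
are continuous functions of `w`. -/
def IsTrigPoly (n : ℕ) (H : ℝ → W → ℂ) : Prop :=
  ∃ q : Polynomial C(W, ℂ), q.natDegree ≤ 2 * n ∧ ∀ (t : ℝ) (w : W),
    Complex.exp (t * Complex.I) ^ n * H t w =
      q.eval₂ (ContinuousMap.evalAlgHom ℂ ℂ w : C(W, ℂ) →+* ℂ) (Complex.exp (t * Complex.I))

namespace IsTrigPoly

lemma mono {m n : ℕ} (hmn : m ≤ n) {H : ℝ → W → ℂ} (h : IsTrigPoly m H) : IsTrigPoly n H := by
  obtain ⟨q, hq, hH⟩ := h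
  refine ⟨q * Polynomial.X ^ (n - m), ?_, fun t w => ?_⟩
  · refine Polynomial.natDegree_mul_le.trans ?_
    have := Polynomial.natDegree_X_pow_le (R := C(W, ℂ)) (n - m)
    omega
  · rw [Polynomial.eval₂_mul, Polynomial.eval₂_X_pow, ← hH t w, mul_right_comm, ← pow_add,
      Nat.add_sub_cancel' hmn]

lemma const (n : ℕ) (f : C(W, ℂ)) : IsTrigPoly n fun _ w => f w := by
  refine IsTrigPoly.mono (m := 0) n.zero_le ⟨Polynomial.C f, by simp, fun t w => ?_⟩
  rw [Polynomial.eval₂_C]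
  simp

lemma mul {m n : ℕ} {H K : ℝ → W → ℂ} (hH : IsTrigPoly m H) (hK : IsTrigPoly n K) :
    IsTrigPoly (m + n) fun t w => H t w * K t w := by
  obtain ⟨p, hp, hH⟩ := hH
  obtain ⟨q, hq, hK⟩ := hK
  refine ⟨p * q, Polynomial.natDegree_mul_le.trans (by omega), fun t w => ?_⟩
  rw [Polynomial.eval₂_mul, ← hH, ← hK]
  ring

lemma add {n : ℕ} {H K : ℝ → W → ℂ} (hH : IsTrigPoly n H) (hK : IsTrigPoly n K) :
    IsTrigPoly n fun t w => H t w + K t w := by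
  obtain ⟨p, hp, hH⟩ := hH
  obtain ⟨q, hq, hK⟩ := hK
  refine ⟨p + q, (Polynomial.natDegree_add_le _ _).trans (max_le hp hq), fun t w => ?_⟩
  rw [Polynomial.eval₂_add, ← hH, ← hK]
  ring

lemma sum {ι : Type*} {n : ℕ} (s : Finset ι) {H : ι → ℝ → W → ℂ}
    (hH : ∀ i ∈ s, IsTrigPoly n (H i)) : IsTrigPoly n fun t w => ∑ i ∈ s, H i t w := by
  classical
  induction s using Finset.induction_on with
  | empty => simpa using const (W := W) n 0
  | insert a s ha ih =>
    simp only [Finset.sum_insert ha]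
    exact (hH a (by simp)).add (ih fun i hi => hH i (by simp [hi]))

lemma pow {n : ℕ} {H : ℝ → W → ℂ} (hH : IsTrigPoly n H) (k : ℕ) :
    IsTrigPoly (k * n) fun t w => H t w ^ k := by
  induction k with
  | zero => simpa using const (W := W) (0 * n) 1
  | succ k ih =>
    simp only [pow_succ, add_mul, one_mul]
    exact ih.mul hH

lemma prod {ι : Type*} {n : ι → ℕ} (s : Finset ι) {H : ι → ℝ → W → ℂ}
    (hH : ∀ i ∈ s, IsTrigPoly (n i) (H i)) :
    IsTrigPoly (∑ i ∈ s, n i) fun t w => ∏ i ∈ s, H i t w := by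
  classical
  induction s using Finset.induction_on with
  | empty => simpa using const (W := W) 0 1
  | insert a s ha ih =>
    simp only [Finset.prod_insert ha, Finset.sum_insert ha]
    exact (hH a (by simp)).mul (ih fun i hi => hH i (by simp [hi]))

lemma cos_sin (f g : C(W, ℂ)) :
    IsTrigPoly 1 fun t w => Real.cos t * f w + Real.sin t * g w := by
  refine ⟨Polynomial.C (ContinuousMap.const W (1 / 2 : ℂ) * (f - ContinuousMap.const W Complex.I * g))
      * Polynomial.X ^ 2
      + Polynomial.C (ContinuousMap.const W (1 / 2 : ℂ) * (f + ContinuousMap.const W Complex.I * g)),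
      by compute_degree, fun t w => ?_⟩
  rw [Polynomial.eval₂_add, Polynomial.eval₂_mul, Polynomial.eval₂_C, Polynomial.eval₂_C,
    Polynomial.eval₂_X_pow]
  have h1 : Complex.exp (t * Complex.I) = Complex.cos t + Complex.sin t * Complex.I :=
    Complex.exp_mul_I _
  have h2 := Complex.sin_sq_add_cos_sq t
  have h3 := Complex.I_sq
  simp only [RingHom.coe_coe, ContinuousMap.evalAlgHom_apply, ContinuousMap.mul_apply,
    ContinuousMap.const_apply, ContinuousMap.sub_apply, ContinuousMap.add_apply, h1,
    Complex.ofReal_cos, Complex.ofReal_sin]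
  generalize Complex.cos t = c at *
  generalize Complex.sin t = s at *
  generalize Complex.I = i at *
  linear_combination (f w + i * g w) / 2 * h2 + (c * s * g w - (f w - i * g w) * s ^ 2 / 2) * h3

/-- A polynomial of total degree at most `n` evaluated at trigonometric polynomials of degree at
most one is a trigonometric polynomial of degree at most `n`. -/
lemma mvPolynomial_eval {σ : Type*} [Fintype σ] {n : ℕ} {P : MvPolynomial σ ℝ}
    (hP : P.totalDegree ≤ n) {x : σ → ℝ → W → ℝ}
    (hx : ∀ i, IsTrigPoly 1 fun t w => (x i t w : ℂ)) :
    IsTrigPoly n fun t w => ((MvPolynomial.eval (fun i => x i t w) P : ℝ) : ℂ) := by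
  simp only [MvPolynomial.eval_eq', Complex.ofReal_sum, Complex.ofReal_mul, Complex.ofReal_prod,
    Complex.ofReal_pow]
  refine sum _ fun m hm => ?_
  refine IsTrigPoly.mono (m := 0 + ∑ i, m i * 1) ?_ ?_
  · have := (MvPolynomial.le_totalDegree hm).trans hP
    rw [Finsupp.sum_fintype _ _ (fun _ => rfl)] at this
    simpa using this
  · exact (const 0 (ContinuousMap.const W ((P.coeff m : ℝ) : ℂ))).mul
      (prod _ fun i _ => (hx i).pow (m i))

end IsTrigPoly

end TrigPolynomial
section Rotation

open scoped RealInnerProductSpace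

variable {W : Type*} [NormedAddCommGroup W] [InnerProductSpace ℝ W]

/-- The map rotating by the angle `t` the plane spanned by the orthonormal pair `e`, `f`. -/
def planeRot (e f : W) (t : ℝ) : W →ₗ[ℝ] W :=
  LinearMap.id + ((Real.cos t - 1) • innerₛₗ ℝ e + Real.sin t • innerₛₗ ℝ f).smulRight e
    + ((Real.cos t - 1) • innerₛₗ ℝ f - Real.sin t • innerₛₗ ℝ e).smulRight f

lemma planeRot_apply (e f : W) (t : ℝ) (z : W) :
    planeRot e f t z = z + ((Real.cos t - 1) * ⟪e, z⟫ + Real.sin t * ⟪f, z⟫) • e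
      + ((Real.cos t - 1) * ⟪f, z⟫ - Real.sin t * ⟪e, z⟫) • f := by
  simp [planeRot]

lemma inner_left_planeRot {e f : W} (he : ‖e‖ = 1) (hef : ⟪e, f⟫ = 0) (t : ℝ) (z : W) :
    ⟪e, planeRot e f t z⟫ = Real.cos t * ⟪e, z⟫ + Real.sin t * ⟪f, z⟫ := by
  rw [planeRot_apply]
  simp only [inner_add_right, real_inner_smul_right, hef, real_inner_self_eq_norm_sq, he]
  ring

lemma inner_right_planeRot {e f : W} (hf : ‖f‖ = 1) (hef : ⟪e, f⟫ = 0) (t : ℝ) (z : W) :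
    ⟪f, planeRot e f t z⟫ = Real.cos t * ⟪f, z⟫ - Real.sin t * ⟪e, z⟫ := by
  rw [planeRot_apply]
  have hfe : ⟪f, e⟫ = 0 := by rw [real_inner_comm, hef]
  simp only [inner_add_right, real_inner_smul_right, hfe, real_inner_self_eq_norm_sq, hf]
  ring

lemma norm_planeRot {e f : W} (he : ‖e‖ = 1) (hf : ‖f‖ = 1) (hef : ⟪e, f⟫ = 0) (t : ℝ) (z : W) :
    ‖planeRot e f t z‖ = ‖z‖ := by
  have hfe : ⟪f, e⟫ = 0 := by rw [real_inner_comm, hef]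
  have hee : ⟪e, e⟫ = 1 := by simp [he]
  have hff : ⟪f, f⟫ = 1 := by simp [hf]
  rw [← sq_eq_sq₀ (norm_nonneg _) (norm_nonneg _), ← real_inner_self_eq_norm_sq,
    ← real_inner_self_eq_norm_sq, planeRot_apply]
  simp only [inner_add_right, inner_add_left, real_inner_smul_right, real_inner_smul_left, hef, hfe,
    real_inner_comm e z, real_inner_comm f z, hee, hff]
  generalize ⟪e, z⟫ = a
  generalize ⟪f, z⟫ = b
  linear_combination (a ^ 2 + b ^ 2) * Real.sin_sq_add_cos_sq t

lemma planeRot_add {e f : W} (he : ‖e‖ = 1) (hf : ‖f‖ = 1) (hef : ⟪e, f⟫ = 0) (s t : ℝ) (z : W) :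
    planeRot e f (s + t) z = planeRot e f s (planeRot e f t z) := by
  rw [planeRot_apply e f s (planeRot e f t z), inner_left_planeRot he hef,
    inner_right_planeRot hf hef, planeRot_apply, planeRot_apply, Real.cos_add, Real.sin_add]
  module

lemma planeRot_zero (e f : W) (z : W) : planeRot e f 0 z = z := by
  simp [planeRot_apply]

end Rotation

section SphereMeasure

variable {W : Type*} [NormedAddCommGroup W] [InnerProductSpace ℝ W] [FiniteDimensional ℝ W]
  [MeasurableSpace W] [BorelSpace W]

/-- The cone measure on the unit sphere, as a measure on the ambient space. -/
def coneMeasure (W : Type*) [NormedAddCommGroup W] [InnerProductSpace ℝ W]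
    [FiniteDimensional ℝ W] [MeasurableSpace W] [BorelSpace W] : Measure W :=
  (volume.restrict (Metric.closedBall 0 1)).map fun z => ‖z‖⁻¹ • z

lemma measurable_inv_norm_smul_self : Measurable fun z : W => ‖z‖⁻¹ • z :=
  measurable_norm.inv.smul measurable_id

instance : IsFiniteMeasure (coneMeasure W) := by
  have : IsFiniteMeasure (volume.restrict (Metric.closedBall (0 : W) 1)) :=
    ⟨by simpa using measure_closedBall_lt_top⟩
  unfold coneMeasure
  infer_instance

lemma ae_coneMeasure_norm_eq_one [Nontrivial W] : ∀ᵐ w ∂coneMeasure W, ‖w‖ = 1 := by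
  rw [coneMeasure, ae_map_iff measurable_inv_norm_smul_self.aemeasurable
    (measurableSet_eq_fun measurable_norm measurable_const)]
  refine ae_restrict_of_ae ?_
  have : ∀ᵐ z : W, z ≠ 0 := by simp [ae_iff]
  filter_upwards [this] with z hz
  simp [norm_smul, hz]

lemma measurePreserving_coneMeasure (L : W →ₗ[ℝ] W) (hL : ∀ z, ‖L z‖ = ‖z‖) :
    MeasurePreserving L (coneMeasure W) (coneMeasure W) := by
  let L' : W ≃ₗᵢ[ℝ] W := LinearIsometry.toLinearIsometryEquiv ⟨L, hL⟩ rfl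
  have hL' : ⇑L' = ⇑L := rfl
  have h1 : MeasurePreserving L (volume.restrict (Metric.closedBall (0 : W) 1))
      (volume.restrict (Metric.closedBall (0 : W) 1)) := by
    have h2 := L'.measurePreserving.restrict_preimage
      (Metric.isClosed_closedBall (x := (0 : W)) (ε := 1)).measurableSet
    have hpre : L' ⁻¹' Metric.closedBall 0 1 = Metric.closedBall 0 1 := by
      ext z
      simp
    rw [hpre] at h2
    exact h2
  refine ⟨h1.measurable, ?_⟩
  unfold coneMeasure
  rw [Measure.map_map h1.measurable measurable_inv_norm_smul_self]
  conv_rhs => rw [← h1.map_eq, Measure.map_map measurable_inv_norm_smul_self h1.measurable]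
  congr 1
  ext z
  simp [hL]

end SphereMeasure
section Projection

open scoped Pointwise

lemma lintegral_Ioi_zero_eq_lintegral_sq (φ : ℝ → ℝ≥0∞) :
    ∫⁻ v in Ioi 0, φ v = ∫⁻ s in Ioi 0, ENNReal.ofReal (2 * s) * φ (s ^ 2) := by
  have himg : (fun s : ℝ => s ^ 2) '' Ioi 0 = Ioi 0 := by
    ext v
    constructor
    · rintro ⟨s, hs, rfl⟩
      exact pow_pos (mem_Ioi.1 hs) 2
    · intro hv
      exact ⟨√v, Real.sqrt_pos.2 hv, Real.sq_sqrt (le_of_lt hv)⟩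
  have h := lintegral_image_eq_lintegral_abs_deriv_mul (s := Ioi (0 : ℝ)) (f := fun s : ℝ => s ^ 2)
    (f' := fun s => 2 * s) measurableSet_Ioi
    (fun x _ => by simpa using (hasDerivAt_pow 2 x).hasDerivWithinAt)
    (fun a ha b hb hab => (sq_eq_sq₀ (le_of_lt ha) (le_of_lt hb)).1 hab) φ
  rw [himg] at h
  rw [h]
  refine setLIntegral_congr_fun measurableSet_Ioi fun s hs => ?_
  have hs' : (0 : ℝ) < s := hs
  simp [abs_of_pos hs']

lemma lintegral_complex_norm_sq {φ : ℝ → ℝ≥0∞} (hφ : Measurable φ) :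
    ∫⁻ y : ℂ, φ (‖y‖ ^ 2) = ENNReal.ofReal Real.pi * ∫⁻ v in Ioi 0, φ v := by
  rw [← Complex.lintegral_comp_polarCoord_symm, lintegral_Ioi_zero_eq_lintegral_sq]
  simp only [Complex.norm_polarCoord_symm, sq_abs, smul_eq_mul]
  rw [show polarCoord.target = Ioi (0 : ℝ) ×ˢ Ioo (-Real.pi) Real.pi from rfl, Measure.volume_eq_prod,
    ← Measure.prod_restrict, lintegral_prod _ (by fun_prop), ← lintegral_const_mul _ (by fun_prop)]
  refine lintegral_congr fun s => ?_
  change ∫⁻ _ in Ioo (-Real.pi) Real.pi, ENNReal.ofReal s * φ (s ^ 2) = _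
  rw [setLIntegral_const, Real.volume_Ioo,
    ENNReal.ofReal_mul (by norm_num : (0 : ℝ) ≤ 2),
    show Real.pi - -Real.pi = 2 * Real.pi by ring, ENNReal.ofReal_mul (by norm_num : (0 : ℝ) ≤ 2)]
  ring

lemma lintegral_complex_add_norm_sq {φ : ℝ → ℝ≥0∞} (hφ : Measurable φ) (a : ℝ) :
    ∫⁻ y : ℂ, φ (a + ‖y‖ ^ 2) = ENNReal.ofReal Real.pi * ∫⁻ v in Ioi a, φ v := by
  rw [lintegral_complex_norm_sq (φ := fun v => φ (a + v)) (by fun_prop)]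
  congr 1
  have h := (measurePreserving_add_left (volume : Measure ℝ) a).setLIntegral_comp_preimage_emb
    (measurableEmbedding_addLeft a) φ (Ioi a)
  rw [← h]
  congr 2
  ext v
  simp

variable {E : Type*} [NormedAddCommGroup E] [InnerProductSpace ℝ E] [FiniteDimensional ℝ E]
  [MeasurableSpace E] [BorelSpace E]

lemma volume_sq_norm_lt_inv_sqrt_smul_mem {v : ℝ} (hv : 0 < v) (A : Set E) :
    volume {x : E | ‖x‖ ^ 2 < v ∧ (√v)⁻¹ • x ∈ A} =
      ENNReal.ofReal (√v ^ Module.finrank ℝ E) * volume (A ∩ Metric.ball 0 1) := by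
  have hs : 0 < √v := Real.sqrt_pos.2 hv
  rw [← Measure.addHaar_smul_of_nonneg _ hs.le]
  congr 1
  ext x
  rw [mem_smul_set_iff_inv_smul_mem₀ hs.ne']
  simp only [mem_ofPred_eq, mem_inter_iff, Metric.mem_ball, dist_zero_right, norm_smul, norm_inv,
    Real.norm_eq_abs, abs_of_pos hs, and_comm, and_congr_left_iff]
  intro _
  rw [inv_mul_lt_one₀ hs, Real.lt_sqrt (norm_nonneg x)]

/-- Archimedes' theorem: the projection of the cone measure of `E × ℂ` to `E` is a multiple of
the Lebesgue measure on the unit ball. -/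
lemma exists_map_fst_coneMeasure [Nontrivial E] :
    ∃ c : ℝ≥0∞, c ≠ 0 ∧ c ≠ ∞ ∧
      (coneMeasure (WithLp 2 (E × ℂ))).map (fun w => w.fst) =
        c • volume.restrict (Metric.closedBall (0 : E) 1) := by
  have hfst : Measurable fun w : WithLp 2 (E × ℂ) => w.fst := by fun_prop
  suffices h : ∃ c : ℝ≥0∞, (coneMeasure (WithLp 2 (E × ℂ))).map (fun w => w.fst) =
      c • volume.restrict (Metric.closedBall (0 : E) 1) by
    obtain ⟨c, hc⟩ := h
    have hball : volume (Metric.closedBall (0 : E) 1) ≠ 0 :=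
      (Metric.measure_closedBall_pos _ _ one_pos).ne'
    have huniv := congrArg (fun μ => μ univ) hc
    simp only [Measure.map_apply hfst MeasurableSet.univ, preimage_univ, Measure.smul_apply,
      Measure.restrict_apply_univ, smul_eq_mul] at huniv
    refine ⟨c, ?_, ?_, hc⟩
    · rintro rfl
      rw [zero_mul, coneMeasure, Measure.map_apply measurable_inv_norm_smul_self MeasurableSet.univ,
        preimage_univ, Measure.restrict_apply_univ] at huniv
      exact (Metric.measure_closedBall_pos volume (0 : WithLp 2 (E × ℂ)) one_pos).ne' huniv
    · rintro rfl
      rw [ENNReal.top_mul hball] at huniv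
      exact measure_ne_top _ _ huniv
  refine ⟨ENNReal.ofReal Real.pi * ∫⁻ v in Ioi 0, (Iic 1).indicator
    (fun v => ENNReal.ofReal (√v ^ Module.finrank ℝ E)) v, ?_⟩
  ext A hA
  have hS : MeasurableSet {p : E × ℝ | p.2 ≤ 1 ∧ (√p.2)⁻¹ • p.1 ∈ A} := by
    refine (measurableSet_le measurable_snd measurable_const).inter ?_
    have : Measurable fun p : E × ℝ => (√p.2)⁻¹ • p.1 := by fun_prop
    exact this hA
  set S : Set (E × ℝ) := {p : E × ℝ | p.2 ≤ 1 ∧ (√p.2)⁻¹ • p.1 ∈ A} with hSdef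
  set Φ : E × ℝ → ℝ≥0∞ := S.indicator 1 with hΦ
  have hΦm : Measurable Φ := measurable_one.indicator hS
  have hset : (fun z : WithLp 2 (E × ℂ) => ‖z‖⁻¹ • z) ⁻¹' ((fun w => w.fst) ⁻¹' A) ∩
      Metric.closedBall 0 1 =
      WithLp.ofLp ⁻¹' {p : E × ℂ | (p.1, ‖p.1‖ ^ 2 + ‖p.2‖ ^ 2) ∈ S} := by
    ext z
    have hz : ‖z‖ = √(‖z.fst‖ ^ 2 + ‖z.snd‖ ^ 2) := WithLp.prod_norm_eq_of_L2 z
    have hz1 : ‖z‖ ≤ 1 ↔ ‖z.fst‖ ^ 2 + ‖z.snd‖ ^ 2 ≤ 1 := by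
      rw [hz, Real.sqrt_le_left zero_le_one, one_pow]
    simp only [mem_inter_iff, mem_preimage, Metric.mem_closedBall, dist_zero_right, hz1,
      mem_ofPred_eq, hSdef, WithLp.smul_fst]
    rw [hz, and_comm]
    rfl
  have hmeas2 : MeasurableSet {p : E × ℂ | (p.1, ‖p.1‖ ^ 2 + ‖p.2‖ ^ 2) ∈ S} := by
    have : Measurable fun p : E × ℂ => (p.1, ‖p.1‖ ^ 2 + ‖p.2‖ ^ 2) := by fun_prop
    exact this hS
  have hball : volume.restrict (Metric.closedBall (0 : E) 1) A
      = volume (A ∩ Metric.ball 0 1) := by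
    rw [Measure.restrict_apply hA]
    refine measure_congr ((ae_eq_refl A).inter (Filter.EventuallyEq.symm ?_))
    exact ae_eq_of_subset_of_measure_ge Metric.ball_subset_closedBall
      (Measure.addHaar_closedBall_eq_addHaar_ball volume (0 : E) 1).le
      Metric.isOpen_ball.measurableSet.nullMeasurableSet measure_closedBall_lt_top.ne
  rw [Measure.map_apply hfst hA, coneMeasure,
    Measure.map_apply measurable_inv_norm_smul_self (hfst hA),
    Measure.restrict_apply (measurable_inv_norm_smul_self (hfst hA)), hset,
    (WithLp.volume_preserving_ofLp E ℂ).measure_preimage hmeas2.nullMeasurableSet,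
    Measure.smul_apply, smul_eq_mul, hball, ← lintegral_indicator_one hmeas2,
    Measure.volume_eq_prod, lintegral_prod _ (measurable_one.indicator hmeas2).aemeasurable]
  calc ∫⁻ x : E, ∫⁻ y : ℂ, {p : E × ℂ | (p.1, ‖p.1‖ ^ 2 + ‖p.2‖ ^ 2) ∈ S}.indicator 1 (x, y)
      = ∫⁻ x : E, ∫⁻ y : ℂ, Φ (x, ‖x‖ ^ 2 + ‖y‖ ^ 2) := rfl
    _ = ∫⁻ x : E, ENNReal.ofReal Real.pi * ∫⁻ v in Ioi (‖x‖ ^ 2), Φ (x, v) := by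
        refine lintegral_congr fun x => ?_
        exact lintegral_complex_add_norm_sq (φ := fun v => Φ (x, v)) (by fun_prop) _
    _ = ENNReal.ofReal Real.pi * ∫⁻ x : E, ∫⁻ v in Ioi 0,
          {p : E × ℝ | ‖p.1‖ ^ 2 < p.2}.indicator Φ (x, v) := by
        rw [← lintegral_const_mul']
        · refine lintegral_congr fun x => ?_
          congr 1
          rw [← lintegral_indicator measurableSet_Ioi, ← lintegral_indicator measurableSet_Ioi]
          refine lintegral_congr fun v => ?_
          by_cases h : ‖x‖ ^ 2 < v
          · have h0 : 0 < v := (sq_nonneg ‖x‖).trans_lt h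
            simp [indicator, h, h0]
          · simp [indicator, h]
        · exact ENNReal.ofReal_ne_top
    _ = ENNReal.ofReal Real.pi * ∫⁻ v in Ioi 0, ∫⁻ x : E,
          {p : E × ℝ | ‖p.1‖ ^ 2 < p.2}.indicator Φ (x, v) := by
        rw [lintegral_lintegral_swap]
        exact (hΦm.indicator (measurableSet_lt (by fun_prop) (by fun_prop))).aemeasurable
    _ = ENNReal.ofReal Real.pi * ((∫⁻ v in Ioi 0, (Iic 1).indicator
          (fun v => ENNReal.ofReal (√v ^ Module.finrank ℝ E)) v)
            * volume (A ∩ Metric.ball 0 1)) := by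
        congr 1
        have h1 : Measurable fun v : ℝ => ENNReal.ofReal (√v ^ Module.finrank ℝ E) := by fun_prop
        rw [← lintegral_mul_const _ (h1.indicator measurableSet_Iic)]
        refine setLIntegral_congr_fun measurableSet_Ioi fun v hv => ?_
        by_cases h : v ≤ 1
        · have h3 : MeasurableSet {x : E | ‖x‖ ^ 2 < v ∧ (√v)⁻¹ • x ∈ A} := by
            refine (measurableSet_lt (measurable_norm.pow_const 2) measurable_const).inter ?_
            have : Measurable fun x : E => (√v)⁻¹ • x := by fun_prop
            exact this hA
          simp only [indicator, mem_Iic, h, if_true]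
          rw [← volume_sq_norm_lt_inv_sqrt_smul_mem hv, ← lintegral_indicator_one h3]
          refine lintegral_congr fun x => ?_
          by_cases h4 : ‖x‖ ^ 2 < v <;> by_cases h5 : (√v)⁻¹ • x ∈ A <;>
            simp [hΦ, hSdef, h, h4, h5]
        · simp [indicator, hΦ, hSdef, h]
    _ = _ := by rw [mul_assoc]

end Projection
section LpRotation

variable {W : Type*} [NormedAddCommGroup W] [InnerProductSpace ℝ W] [FiniteDimensional ℝ W]
  [MeasurableSpace W] [BorelSpace W]

lemma memLp_coneMeasure_of_continuous [Nontrivial W] {F : Type*} [NormedAddCommGroup F]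
    [SecondCountableTopologyEither W F] {g : W → F} (hg : Continuous g) (p : ℝ≥0∞) :
    MemLp g p (coneMeasure W) := by
  obtain ⟨C, hC⟩ := (isCompact_sphere (0 : W) 1).exists_bound_of_continuousOn hg.continuousOn
  refine MemLp.of_bound hg.aestronglyMeasurable C ?_
  filter_upwards [ae_coneMeasure_norm_eq_one] with w hw
  exact hC w (by simpa using hw)

/-- The inclusion of continuous functions into `L^p` of the cone measure. -/
def coneToLp [Nontrivial W] (p : ℝ≥0∞) : C(W, ℂ) →ₗ[ℂ] Lp ℂ p (coneMeasure W) where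
  toFun g := (memLp_coneMeasure_of_continuous g.continuous p).toLp g
  map_add' _ _ := rfl
  map_smul' _ _ := rfl

lemma norm_coneToLp [Nontrivial W] (p : ℝ≥0∞) (g : C(W, ℂ)) :
    ‖coneToLp p g‖ = (eLpNorm g p (coneMeasure W)).toReal :=
  Lp.norm_toLp _ (memLp_coneMeasure_of_continuous g.continuous p)

/-- If `G ∘ R t` is a trigonometric polynomial of degree `n` in `t`, where `R t` are isometries,
then it is Lipschitz in `L^p` with constant `7 * n * ‖G‖_p`. -/
lemma eLpNorm_comp_sub_le [Nontrivial W] {n : ℕ} (hn : 0 < n) {p : ℝ≥0∞} (hp : 1 ≤ p)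
    {G : W → ℝ} (hG : Continuous G) {R : ℝ → W →ₗ[ℝ] W} (hR : ∀ t z, ‖R t z‖ = ‖z‖)
    (hR0 : ∀ z, R 0 z = z) (hGR : IsTrigPoly n fun t w => (G (R t w) : ℂ)) (t : ℝ) :
    eLpNorm (fun w => G (R t w) - G w) p (coneMeasure W) ≤
      ENNReal.ofReal (7 * n * |t|) * eLpNorm G p (coneMeasure W) := by
  have : Fact (1 ≤ p) := ⟨hp⟩
  obtain ⟨q, hq, hqt⟩ := hGR
  have hRc (t : ℝ) : Continuous (R t) := (R t).continuous_of_finiteDimensional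
  let U (t : ℝ) : C(W, ℂ) := ⟨fun w => (G (R t w) : ℂ),
    Complex.continuous_ofReal.comp (hG.comp (hRc t))⟩
  have hfin : eLpNorm G p (coneMeasure W) ≠ ∞ :=
    (memLp_coneMeasure_of_continuous hG p).eLpNorm_ne_top
  have hUnorm (t : ℝ) : eLpNorm (U t) p (coneMeasure W) = eLpNorm G p (coneMeasure W) := by
    rw [← eLpNorm_comp_measurePreserving hG.aestronglyMeasurable
      (measurePreserving_coneMeasure (R t) (hR t))]
    exact eLpNorm_congr_norm_ae (Filter.Eventually.of_forall fun w => by simp [U])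
  have key := norm_trigPoly_sub_le hn (v := fun k => coneToLp p (q.coeff k))
    (u := fun t => coneToLp p (U t)) (M := (eLpNorm G p (coneMeasure W)).toReal)
    (fun t => by
      simp only [← map_smul, ← map_sum]
      congr 1
      ext w
      have h := hqt t w
      rw [Polynomial.eval₂_eq_sum_range' _ (Nat.lt_succ_of_le hq)] at h
      simpa [U, ContinuousMap.sum_apply, mul_comm] using h)
    (fun t => by rw [norm_coneToLp, hUnorm]) t
  rw [← map_sub, norm_coneToLp] at key
  have hsub : eLpNorm (U t - U 0 : C(W, ℂ)) p (coneMeasure W) =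
      eLpNorm (fun w => G (R t w) - G w) p (coneMeasure W) := by
    refine eLpNorm_congr_norm_ae (Filter.Eventually.of_forall fun w => ?_)
    simp only [U, ContinuousMap.sub_apply, ContinuousMap.coe_mk, hR0, ← Complex.ofReal_sub,
      Complex.norm_real]
  rw [hsub] at key
  have hfin2 : eLpNorm (fun w => G (R t w) - G w) p (coneMeasure W) ≠ ∞ :=
    (memLp_coneMeasure_of_continuous ((hG.comp (hRc t)).sub hG) p).eLpNorm_ne_top
  rw [← ENNReal.ofReal_toReal hfin2]
  refine (ENNReal.ofReal_le_ofReal key).trans ?_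
  rw [mul_right_comm, ENNReal.ofReal_mul (by positivity), ENNReal.ofReal_toReal hfin]

/-- If every point of `B` is moved out of `B` by one of finitely many measure preserving maps `T j`
with `‖G ∘ T j - G‖_p ≤ ε ‖G‖_p`, then the norm of `G` is controlled by its norm outside `B`. -/
lemma eLpNorm_le_of_exists_notMem {α ι : Type*} [Fintype ι] [MeasurableSpace α] {μ : Measure α}
    {p : ℝ≥0∞} (hp : 1 ≤ p) {G : α → ℝ} (hG : MemLp G p μ) {B : Set α} (hB : MeasurableSet B)
    {T : ι → α → α} (hT : ∀ j, MeasurePreserving (T j) μ μ)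
    (hesc : ∀ᵐ w ∂μ, w ∈ B → ∃ j, T j w ∉ B) {ε : ℝ≥0∞}
    (hε : ∀ j, eLpNorm (fun w => G (T j w) - G w) p μ ≤ ε * eLpNorm G p μ)
    (hsmall : Fintype.card ι * ε ≤ 1 / 2) :
    eLpNorm G p μ ≤ 2 * (1 + Fintype.card ι) * eLpNorm (Bᶜ.indicator G) p μ := by
  have hGB : AEStronglyMeasurable (Bᶜ.indicator G) μ := hG.aestronglyMeasurable.indicator hB.compl
  have hGT (j : ι) : AEStronglyMeasurable (fun w => G (T j w) - G w) μ :=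
    (hG.aestronglyMeasurable.comp_measurePreserving (hT j)).sub hG.aestronglyMeasurable
  have hGBT (j : ι) : AEStronglyMeasurable (fun w => Bᶜ.indicator G (T j w)) μ :=
    hGB.comp_measurePreserving (hT j)
  have hGBn : eLpNorm (Bᶜ.indicator G) p μ ≤ eLpNorm G p μ := eLpNorm_indicator_le G
  have hpt : ∀ᵐ w ∂μ, ‖G w‖ ≤ ‖(fun w => |Bᶜ.indicator G w| +
      ∑ j, (|Bᶜ.indicator G (T j w)| + |G (T j w) - G w|)) w‖ := by
    filter_upwards [hesc] with w hw
    have hnn : 0 ≤ ∑ j, (|Bᶜ.indicator G (T j w)| + |G (T j w) - G w|) :=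
      Finset.sum_nonneg fun j _ => by positivity
    rw [Real.norm_eq_abs, Real.norm_eq_abs]
    refine le_trans ?_ (le_abs_self _)
    by_cases hwB : w ∈ B
    · obtain ⟨j, hj⟩ := hw hwB
      have h1 := Finset.single_le_sum
        (f := fun j => |Bᶜ.indicator G (T j w)| + |G (T j w) - G w|)
        (fun j _ => by positivity) (Finset.mem_univ j)
      have h2 : |G w| ≤ |G (T j w)| + |G (T j w) - G w| := by
        have := abs_sub (G (T j w)) (G (T j w) - G w)
        simpa using this
      simp only [indicator_of_mem (mem_compl hj)] at h1
      have := abs_nonneg (Bᶜ.indicator G w)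
      linarith
    · rw [indicator_of_mem (mem_compl hwB)]
      linarith
  have h1 : eLpNorm G p μ ≤ eLpNorm (Bᶜ.indicator G) p μ +
      Fintype.card ι * (eLpNorm (Bᶜ.indicator G) p μ + ε * eLpNorm G p μ) := by
    calc eLpNorm G p μ ≤ eLpNorm (fun w => |Bᶜ.indicator G w| +
          ∑ j, (|Bᶜ.indicator G (T j w)| + |G (T j w) - G w|)) p μ := eLpNorm_mono_ae hpt
      _ ≤ eLpNorm (fun w => |Bᶜ.indicator G w|) p μ +
          eLpNorm (fun w => ∑ j, (|Bᶜ.indicator G (T j w)| + |G (T j w) - G w|)) p μ := by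
        refine eLpNorm_add_le hGB.norm ?_ hp
        exact Finset.aestronglyMeasurable_fun_sum _ fun j _ => (hGBT j).norm.add (hGT j).norm
      _ ≤ eLpNorm (fun w => |Bᶜ.indicator G w|) p μ +
          ∑ j, eLpNorm (fun w => |Bᶜ.indicator G (T j w)| + |G (T j w) - G w|) p μ := by
        gcongr
        have hsum : (fun w => ∑ j, (|Bᶜ.indicator G (T j w)| + |G (T j w) - G w|)) =
            ∑ j, fun w => |Bᶜ.indicator G (T j w)| + |G (T j w) - G w| := by
          ext w
          rw [Finset.sum_apply]
        rw [hsum]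
        exact eLpNorm_sum_le (fun j _ => (hGBT j).norm.add (hGT j).norm) hp
      _ ≤ eLpNorm (Bᶜ.indicator G) p μ +
          ∑ _j : ι, (eLpNorm (Bᶜ.indicator G) p μ + ε * eLpNorm G p μ) := by
        gcongr with j
        · exact (eLpNorm_norm (Bᶜ.indicator G)).le
        · refine (eLpNorm_add_le (hGBT j).norm (hGT j).norm hp).trans ?_
          refine add_le_add ?_ ?_
          · refine (eLpNorm_norm fun w => Bᶜ.indicator G (T j w)).le.trans ?_
            exact (eLpNorm_comp_measurePreserving hGB (hT j)).le
          · exact (eLpNorm_norm fun w => G (T j w) - G w).le.trans (hε j)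
      _ = _ := by rw [Finset.sum_const, Finset.card_univ, nsmul_eq_mul]
  have hfin := hG.eLpNorm_ne_top
  have hfinB := ne_top_of_le_ne_top hfin hGBn
  generalize eLpNorm G p μ = x at *
  generalize eLpNorm (Bᶜ.indicator G) p μ = y at *
  have h2 : x ≤ (1 + Fintype.card ι) * y + 1 / 2 * x := by
    refine h1.trans ?_
    calc y + Fintype.card ι * (y + ε * x) = (1 + Fintype.card ι) * y + Fintype.card ι * ε * x := by
          ring
      _ ≤ _ := by gcongr
  have h3 : x / 2 + x / 2 ≤ (1 + Fintype.card ι) * y + x / 2 := by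
    rw [ENNReal.add_halves]
    convert h2 using 2
    rw [mul_comm, mul_one_div]
  have h4 : x / 2 ≤ (1 + Fintype.card ι) * y :=
    (ENNReal.add_le_add_iff_right (ENNReal.div_ne_top hfin two_ne_zero)).1 h3
  calc x = 2 * (x / 2) := (ENNReal.mul_div_cancel two_ne_zero ENNReal.ofNat_ne_top).symm
    _ ≤ 2 * ((1 + Fintype.card ι) * y) := by gcongr
    _ = _ := by rw [mul_assoc]

end LpRotation

section RotationEstimates

lemma three_quarters_mul_le_sin {t : ℝ} (h0 : 0 ≤ t) (h1 : t ≤ 1) : 3 / 4 * t ≤ Real.sin t := by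
  rcases h0.eq_or_lt with rfl | h0
  · simp
  · have := Real.sin_gt_sub_cube h0
    have h3 : t ^ 3 ≤ t := pow_le_of_le_one h0.le h1 (by norm_num)
    linarith

lemma le_abs_rotated_sub_self {D t α β : ℝ} (hD : 1 ≤ D) (ht0 : 0 ≤ t) (ht : t ≤ 1 / (4 * D))
    (hα : |α| ≤ 1) (hβ : 1 / (3 * D) ≤ |β|) :
    t / (8 * D) ≤ |Real.cos t * α + Real.sin t * β - α| := by
  have ht1 : t ≤ 1 := ht.trans (by rw [div_le_one (by positivity)]; linarith)
  have hs := three_quarters_mul_le_sin ht0 ht1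
  have hc := Real.one_sub_sq_div_two_le_cos (x := t)
  have hc1 := Real.cos_le_one t
  have h1 : |Real.sin t * β| - |(1 - Real.cos t) * α| ≤
      |Real.cos t * α + Real.sin t * β - α| := by
    have := abs_sub_abs_le_abs_sub (Real.sin t * β) ((1 - Real.cos t) * α)
    rwa [show Real.sin t * β - (1 - Real.cos t) * α =
      Real.cos t * α + Real.sin t * β - α by ring] at this
  have hs0 : 0 ≤ Real.sin t := by linarith
  rw [abs_mul, abs_mul, abs_of_nonneg hs0,
    abs_of_nonneg (by linarith : 0 ≤ 1 - Real.cos t)] at h1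
  have h2 : 3 / 4 * t * (1 / (3 * D)) ≤ Real.sin t * |β| := by gcongr
  have h3 : (1 - Real.cos t) * |α| ≤ t * (1 / (4 * D)) / 2 * 1 := by
    refine mul_le_mul ?_ hα (abs_nonneg _) (by positivity)
    have : t * t ≤ t * (1 / (4 * D)) := by gcongr
    nlinarith
  have h4 : 3 / 4 * t * (1 / (3 * D)) - t * (1 / (4 * D)) / 2 * 1 = t / (8 * D) := by
    field_simp; ring
  linarith

lemma add_le_of_rotated {D t α β h h' : ℝ} (hD : 1 ≤ D) (ht0 : 0 ≤ t)
    (ht : t ≤ 1 / (4 * D)) (hα : 1 / (2 * D) ≤ |α|) (hβ : |β| ≤ 1) (hβh : h ^ 2 ≤ 2 * β ^ 2)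
    (hh' : 0 ≤ h') (hsign : β * α ≤ 0)
    (he : h' ^ 2 = h ^ 2 + (Real.cos t * β - Real.sin t * α) ^ 2 - β ^ 2) :
    h + t / (8 * D) ≤ h' := by
  have ht1 : t ≤ 1 := ht.trans (by rw [div_le_one (by positivity)]; linarith)
  have hs := three_quarters_mul_le_sin ht0 ht1
  have hc := Real.one_sub_sq_div_two_le_cos (x := t)
  have hc0 : 0 ≤ Real.cos t := by nlinarith
  have hs0 : 0 ≤ Real.sin t := by linarith
  have h1 : |Real.cos t * β - Real.sin t * α| = Real.cos t * |β| + Real.sin t * |α| := by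
    rw [← abs_of_nonneg hc0, ← abs_of_nonneg hs0, ← abs_mul, ← abs_mul, abs_of_nonneg hc0,
      abs_of_nonneg hs0, sub_eq_add_neg, ← abs_neg (Real.sin t * α), abs_add_eq_add_abs_iff]
    rcases mul_nonpos_iff.1 hsign with ⟨hb, ha⟩ | ⟨hb, ha⟩
    · left; constructor <;> nlinarith
    · right; constructor <;> nlinarith
  have h2 : 3 / 4 * t * (1 / (2 * D)) ≤ Real.sin t * |α| := by gcongr
  have h3 : (1 - Real.cos t) * |β| ≤ t * (1 / (4 * D)) / 2 * 1 := by
    refine mul_le_mul ?_ hβ (abs_nonneg _) (by positivity)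
    have : t * t ≤ t * (1 / (4 * D)) := by gcongr
    nlinarith
  have h4 : 3 / 4 * t * (1 / (2 * D)) - t * (1 / (4 * D)) / 2 * 1 = 2 * (t / (8 * D)) := by
    field_simp; ring
  set τ := t / (8 * D) with hτ
  have hτ0 : 0 ≤ τ := by positivity
  have h5 : |β| + 2 * τ ≤ |Real.cos t * β - Real.sin t * α| := by rw [h1]; linarith
  have h6 : h ≤ 2 * |β| := by
    refine abs_le_of_sq_le_sq' ?_ (by positivity) |>.2
    rw [mul_pow, sq_abs]
    nlinarith [sq_nonneg β]
  have h7 : (|β| + 2 * τ) ^ 2 ≤ (Real.cos t * β - Real.sin t * α) ^ 2 := by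
    rw [← sq_abs (Real.cos t * β - Real.sin t * α)]
    gcongr
  refine abs_le_of_sq_le_sq' ?_ hh' |>.2
  rw [he]
  have := sq_abs β
  nlinarith

end RotationEstimates

section BallGeometry

open scoped RealInnerProductSpace

variable {d : ℕ}

lemma rhoBall_comm (x y : EuclideanSpace ℝ (Fin d)) : rhoBall x y = rhoBall y x := by
  simp only [rhoBall, dist_comm x y, abs_sub_comm]

lemma rhoBall_triangle (x y z : EuclideanSpace ℝ (Fin d)) :
    rhoBall x z ≤ rhoBall x y + rhoBall y z := by
  have h1 := dist_triangle x y z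
  have h2 := abs_sub_le (√(1 - ‖x‖ ^ 2)) (√(1 - ‖y‖ ^ 2)) (√(1 - ‖z‖ ^ 2))
  simp only [rhoBall]
  linarith

lemma isClosed_ballB (x : EuclideanSpace ℝ (Fin d)) (r : ℝ) : IsClosed (ballB x r) := by
  have h : Continuous (rhoBall x) := by
    unfold rhoBall
    fun_prop
  exact (isClosed_le continuous_norm continuous_const).inter (isClosed_le h continuous_const)

/-- The horizontal unit vectors of `ℝ^d × ℂ`. -/
def ballAxis (i : Fin d) : WithLp 2 (EuclideanSpace ℝ (Fin d) × ℂ) :=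
  WithLp.toLp 2 (EuclideanSpace.single i 1, 0)

/-- The vertical vectors of `ℝ^d × ℂ`. -/
def fiberAxis (d : ℕ) (u : ℂ) : WithLp 2 (EuclideanSpace ℝ (Fin d) × ℂ) :=
  WithLp.toLp 2 (0, u)

lemma inner_ballAxis (i : Fin d) (w : WithLp 2 (EuclideanSpace ℝ (Fin d) × ℂ)) :
    ⟪ballAxis i, w⟫ = w.fst i := by
  simp [ballAxis, WithLp.prod_inner_apply, EuclideanSpace.inner_single_left]

lemma inner_fiberAxis (u : ℂ) (w : WithLp 2 (EuclideanSpace ℝ (Fin d) × ℂ)) :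
    ⟪fiberAxis d u, w⟫ = ⟪u, w.snd⟫ := by
  simp [fiberAxis, WithLp.prod_inner_apply]

lemma norm_ballAxis (i : Fin d) : ‖ballAxis i‖ = 1 := by
  rw [← sq_eq_sq₀ (norm_nonneg _) zero_le_one, WithLp.prod_norm_sq_eq_of_L2]
  simp [ballAxis]

lemma norm_fiberAxis {u : ℂ} (hu : ‖u‖ = 1) : ‖fiberAxis d u‖ = 1 := by
  rw [← sq_eq_sq₀ (norm_nonneg _) zero_le_one, WithLp.prod_norm_sq_eq_of_L2]
  simp [fiberAxis, hu]

lemma inner_ballAxis_fiberAxis (i : Fin d) (u : ℂ) : ⟪ballAxis i, fiberAxis d u⟫ = 0 := by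
  rw [inner_ballAxis]
  rfl

/-- The rotation of `ℝ^d × ℂ` in the plane spanned by a horizontal and a vertical axis. -/
abbrev axisRot (i : Fin d) (u : ℂ) (t : ℝ) :
    WithLp 2 (EuclideanSpace ℝ (Fin d) × ℂ) →ₗ[ℝ] WithLp 2 (EuclideanSpace ℝ (Fin d) × ℂ) :=
  planeRot (ballAxis i) (fiberAxis d u) t

lemma norm_axisRot (i : Fin d) {u : ℂ} (hu : ‖u‖ = 1) (t : ℝ)
    (w : WithLp 2 (EuclideanSpace ℝ (Fin d) × ℂ)) : ‖axisRot i u t w‖ = ‖w‖ :=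
  norm_planeRot (norm_ballAxis i) (norm_fiberAxis hu) (inner_ballAxis_fiberAxis i u) t w

lemma axisRot_fst_same (i : Fin d) (u : ℂ) (t : ℝ)
    (w : WithLp 2 (EuclideanSpace ℝ (Fin d) × ℂ)) :
    (axisRot i u t w).fst i = Real.cos t * w.fst i + Real.sin t * ⟪u, w.snd⟫ := by
  rw [← inner_ballAxis, inner_left_planeRot (norm_ballAxis i) (inner_ballAxis_fiberAxis i u),
    inner_ballAxis, inner_fiberAxis]

lemma axisRot_fst_of_ne {i l : Fin d} (h : l ≠ i) (u : ℂ) (t : ℝ)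
    (w : WithLp 2 (EuclideanSpace ℝ (Fin d) × ℂ)) : (axisRot i u t w).fst l = w.fst l := by
  simp [axisRot, planeRot_apply, ballAxis, fiberAxis, h]

lemma axisRot_snd (i : Fin d) (u : ℂ) (t : ℝ) (w : WithLp 2 (EuclideanSpace ℝ (Fin d) × ℂ)) :
    (axisRot i u t w).snd =
      w.snd + (Real.cos t * ⟪u, w.snd⟫ - Real.sin t * w.fst i - ⟪u, w.snd⟫) • u := by
  rw [axisRot, planeRot_apply, inner_ballAxis, inner_fiberAxis]
  have h1 : (ballAxis i).snd = 0 := rfl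
  have h2 : (fiberAxis d u).snd = u := rfl
  rw [WithLp.add_snd, WithLp.add_snd, WithLp.smul_snd, WithLp.smul_snd, h1, h2, smul_zero,
    add_zero]
  congr 2
  ring

lemma norm_axisRot_snd_sq (i : Fin d) {u : ℂ} (hu : ‖u‖ = 1) (t : ℝ)
    (w : WithLp 2 (EuclideanSpace ℝ (Fin d) × ℂ)) :
    ‖(axisRot i u t w).snd‖ ^ 2 = ‖w.snd‖ ^ 2 +
      (Real.cos t * ⟪u, w.snd⟫ - Real.sin t * w.fst i) ^ 2 - ⟪u, w.snd⟫ ^ 2 := by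
  rw [axisRot_snd, norm_add_sq_real, real_inner_smul_right, norm_smul, hu,
    real_inner_comm u w.snd, mul_one, Real.norm_eq_abs, sq_abs]
  ring

lemma norm_planeRot_sub_self_le {W : Type*} [NormedAddCommGroup W] [InnerProductSpace ℝ W]
    {e f : W} (he : ‖e‖ = 1) (hf : ‖f‖ = 1) (hef : ⟪e, f⟫ = 0) (t : ℝ) (z : W) :
    ‖planeRot e f t z - z‖ ≤ |t| * ‖z‖ := by
  have hR := norm_planeRot he hf hef t z
  have hbessel : ⟪e, z⟫ ^ 2 + ⟪f, z⟫ ^ 2 ≤ ‖z‖ ^ 2 := by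
    have hfe : ⟪f, e⟫ = 0 := by rw [real_inner_comm, hef]
    have hee : ⟪e, e⟫ = 1 := by simp [he]
    have hff : ⟪f, f⟫ = 1 := by simp [hf]
    have h := real_inner_self_nonneg (x := z - ⟪e, z⟫ • e - ⟪f, z⟫ • f)
    simp only [inner_sub_right, inner_sub_left, real_inner_smul_right, real_inner_smul_left, hef,
      hfe, real_inner_comm e z, real_inner_comm f z, hee, hff] at h
    rw [← real_inner_self_eq_norm_sq]
    linarith
  have hsq : ‖planeRot e f t z - z‖ ^ 2 =
      2 * (1 - Real.cos t) * (⟪e, z⟫ ^ 2 + ⟪f, z⟫ ^ 2) := by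
    rw [norm_sub_sq_real, hR, planeRot_apply]
    simp only [inner_add_left, real_inner_smul_left, real_inner_self_eq_norm_sq]
    ring
  refine abs_le_of_sq_le_sq' ?_ (by positivity) |>.2
  rw [hsq, mul_pow, sq_abs]
  have hc := Real.one_sub_sq_div_two_le_cos (x := t)
  have hc1 := Real.cos_le_one t
  gcongr
  linarith

lemma sqrt_one_sub_norm_fst_sq {w : WithLp 2 (EuclideanSpace ℝ (Fin d) × ℂ)} (hw : ‖w‖ = 1) :
    √(1 - ‖w.fst‖ ^ 2) = ‖w.snd‖ := by
  have h := WithLp.prod_norm_sq_eq_of_L2 w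
  rw [hw] at h
  rw [show 1 - ‖w.fst‖ ^ 2 = ‖w.snd‖ ^ 2 by linarith, Real.sqrt_sq (norm_nonneg _)]

lemma rhoBall_fst {w z : WithLp 2 (EuclideanSpace ℝ (Fin d) × ℂ)} (hw : ‖w‖ = 1) (hz : ‖z‖ = 1) :
    rhoBall w.fst z.fst = ‖w.fst - z.fst‖ + |‖w.snd‖ - ‖z.snd‖| := by
  rw [rhoBall, sqrt_one_sub_norm_fst_sq hw, sqrt_one_sub_norm_fst_sq hz, dist_eq_norm]

lemma rhoBall_fst_le {w z : WithLp 2 (EuclideanSpace ℝ (Fin d) × ℂ)} (hw : ‖w‖ = 1)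
    (hz : ‖z‖ = 1) : rhoBall w.fst z.fst ≤ 2 * ‖w - z‖ := by
  rw [rhoBall_fst hw hz]
  have h := WithLp.prod_norm_sq_eq_of_L2 (w - z)
  rw [WithLp.sub_fst, WithLp.sub_snd] at h
  have h1 : ‖w.fst - z.fst‖ ≤ ‖w - z‖ :=
    (abs_le_of_sq_le_sq' (by rw [h]; nlinarith [norm_nonneg (w.snd - z.snd)]) (norm_nonneg _)).2
  have h2 : ‖w.snd - z.snd‖ ≤ ‖w - z‖ :=
    (abs_le_of_sq_le_sq' (by rw [h]; nlinarith [norm_nonneg (w.fst - z.fst)]) (norm_nonneg _)).2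
  linarith [abs_norm_sub_norm_le w.snd z.snd]

/-- The vertical directions `1` and `I`. -/
def fiberDir (a : Bool) : ℂ := cond a 1 Complex.I

lemma norm_fiberDir (a : Bool) : ‖fiberDir a‖ = 1 := by
  cases a <;> simp [fiberDir]

lemma exists_norm_sq_le_two_mul_inner_fiberDir_sq (z : ℂ) :
    ∃ a, ‖z‖ ^ 2 ≤ 2 * ⟪fiberDir a, z⟫ ^ 2 := by
  have h : ‖z‖ ^ 2 = z.re ^ 2 + z.im ^ 2 := by
    rw [Complex.sq_norm, Complex.normSq_apply]; ring
  rcases le_total (z.im ^ 2) (z.re ^ 2) with h1 | h1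
  · refine ⟨true, ?_⟩
    have : ⟪fiberDir true, z⟫ = z.re := by simp [fiberDir, Complex.inner]
    rw [this]; linarith
  · refine ⟨false, ?_⟩
    have : ⟪fiberDir false, z⟫ = z.im := by simp [fiberDir, Complex.inner]
    rw [this]; linarith

/-- One of the rotations by the angle `±t` moves the projection to the ball by at least
`t / (8 * d)`. -/
lemma exists_le_rhoBall_axisRot (hd : 1 ≤ d) {t : ℝ} (ht0 : 0 ≤ t) (ht : t ≤ 1 / (4 * d))
    {w : WithLp 2 (EuclideanSpace ℝ (Fin d) × ℂ)} (hw : ‖w‖ = 1) :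
    ∃ (i : Fin d) (a : Bool) (b : Bool),
      t / (8 * d) ≤ rhoBall w.fst (axisRot i (fiberDir a) (cond b t (-t)) w).fst := by
  have hD : (1 : ℝ) ≤ d := by exact_mod_cast hd
  have hsum := WithLp.prod_norm_sq_eq_of_L2 w
  rw [hw] at hsum
  have hx1 (i : Fin d) : |w.fst i| ≤ 1 := by
    have h := EuclideanSpace.real_norm_sq_eq w.fst
    have h2 := Finset.single_le_sum (f := fun i => w.fst i ^ 2) (fun i _ => sq_nonneg _)
      (Finset.mem_univ i)
    simp only at h2
    refine abs_le_one_iff_mul_self_le_one.2 ?_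
    nlinarith [norm_nonneg w.snd]
  obtain ⟨a, ha⟩ := exists_norm_sq_le_two_mul_inner_fiberDir_sq w.snd
  have hu := norm_fiberDir a
  have hnorm (i : Fin d) (s : ℝ) : ‖axisRot i (fiberDir a) s w‖ = 1 := by rw [norm_axisRot i hu, hw]
  by_cases hh : 1 / (4 * d) ≤ ‖w.snd‖ ^ 2
  · refine ⟨⟨0, hd⟩, a, true, ?_⟩
    set i : Fin d := ⟨0, hd⟩
    have hβ : 1 / (3 * d) ≤ |⟪fiberDir a, w.snd⟫| := by
      refine abs_le_of_sq_le_sq' ?_ (abs_nonneg _) |>.2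
      rw [sq_abs]
      have : (1 / (3 * d) : ℝ) ^ 2 ≤ 1 / (4 * d) / 2 := by
        rw [div_pow, div_div, div_le_div_iff₀ (by positivity) (by positivity)]
        nlinarith
      linarith
    refine (le_abs_rotated_sub_self hD ht0 ht (hx1 i) hβ).trans ?_
    rw [← axisRot_fst_same, rhoBall_fst hw (hnorm i _), norm_sub_rev]
    refine le_trans ?_ (le_add_of_nonneg_right (abs_nonneg _))
    exact PiLp.norm_apply_le ((axisRot i (fiberDir a) t w).fst - w.fst) i
  · have hx : ∃ i, 1 / (2 * d) ≤ |w.fst i| := by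
      by_contra! hcon
      have h := EuclideanSpace.real_norm_sq_eq w.fst
      have h2 : ∑ i, w.fst i ^ 2 ≤ ∑ _i : Fin d, (1 / (2 * d) : ℝ) ^ 2 := by
        refine Finset.sum_le_sum fun i _ => ?_
        rw [← sq_abs]
        have := (hcon i).le
        gcongr
      rw [Finset.sum_const, Finset.card_univ, Fintype.card_fin, nsmul_eq_mul] at h2
      have h3 : (d : ℝ) * (1 / (2 * d)) ^ 2 = 1 / (4 * d) := by field_simp; norm_num
      have h4 : 1 / (4 * (d : ℝ)) ≤ 1 / 4 := by
        gcongr; linarith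
      push Not at hh
      linarith
    obtain ⟨i, hi⟩ := hx
    have hβ1 : |⟪fiberDir a, w.snd⟫| ≤ 1 := by
      refine (abs_real_inner_le_norm _ _).trans ?_
      rw [hu, one_mul]
      refine abs_le_of_sq_le_sq' ?_ zero_le_one |>.2
      nlinarith [norm_nonneg w.fst]
    have key (b : Bool) (α : ℝ) (hα : 1 / (2 * d) ≤ |α|) (hsign : ⟪fiberDir a, w.snd⟫ * α ≤ 0)
        (hrot : ‖(axisRot i (fiberDir a) (cond b t (-t)) w).snd‖ ^ 2 = ‖w.snd‖ ^ 2 +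
          (Real.cos t * ⟪fiberDir a, w.snd⟫ - Real.sin t * α) ^ 2 - ⟪fiberDir a, w.snd⟫ ^ 2) :
        t / (8 * d) ≤ rhoBall w.fst (axisRot i (fiberDir a) (cond b t (-t)) w).fst := by
      have := add_le_of_rotated hD ht0 ht hα hβ1 ha (norm_nonneg _)
        hsign hrot
      rw [rhoBall_fst hw (hnorm i _), abs_sub_comm]
      have h1 := le_abs_self (‖(axisRot i (fiberDir a) (cond b t (-t)) w).snd‖ - ‖w.snd‖)
      have h2 := norm_nonneg (w.fst - (axisRot i (fiberDir a) (cond b t (-t)) w).fst)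
      linarith
    rcases le_total (⟪fiberDir a, w.snd⟫ * w.fst i) 0 with hs | hs
    · refine ⟨i, a, true, key true (w.fst i) hi hs ?_⟩
      exact norm_axisRot_snd_sq i hu t w
    · refine ⟨i, a, false, key false (-w.fst i) (by rwa [abs_neg]) (by linarith) ?_⟩
      have := norm_axisRot_snd_sq i hu (-t) w
      rw [Real.cos_neg, Real.sin_neg] at this
      simpa using this

/-- Around an `r`-separated set, each point of the sphere over the balls of radius `r / 4` leaves
these balls under one of finitely many rotations. -/
lemma exists_axisRot_fst_notMem (hd : 1 ≤ d) {r : ℝ} (hr0 : 0 < r) (hr : r ≤ 1 / (32 * d ^ 2))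
    {m : ℕ} {ξ : Fin m → EuclideanSpace ℝ (Fin d)}
    (hsep : ∀ i j, i ≠ j → r ≤ rhoBall (ξ i) (ξ j))
    {w : WithLp 2 (EuclideanSpace ℝ (Fin d) × ℂ)} (hw : ‖w‖ = 1)
    (hmem : w.fst ∈ ⋃ j, ballB (ξ j) (r / 4)) :
    ∃ (i : Fin d) (a : Bool) (b : Bool) (k : Fin (64 * d + 1)),
      (axisRot i (fiberDir a) (cond b (k * (r / 8)) (-(k * (r / 8)))) w).fst ∉
        ⋃ j, ballB (ξ j) (r / 4) := by
  have hD : (1 : ℝ) ≤ d := by exact_mod_cast hd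
  obtain ⟨j, hj⟩ := mem_iUnion.1 hmem
  have hT : ((64 * d : ℕ) : ℝ) * (r / 8) ≤ 1 / (4 * d) := by
    push_cast
    calc 64 * (d : ℝ) * (r / 8) ≤ 64 * (d : ℝ) * (1 / (32 * d ^ 2) / 8) := by gcongr
      _ = 1 / (4 * d) := by field_simp; norm_num
  obtain ⟨i, a, b, hiab⟩ := exists_le_rhoBall_axisRot hd (by positivity) hT hw
  have hr' : ((64 * d : ℕ) : ℝ) * (r / 8) / (8 * d) = r := by
    push_cast; field_simp; norm_num
  rw [hr'] at hiab
  let θ (k : ℕ) : ℝ := cond b (k * (r / 8)) (-(k * (r / 8)))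
  let y (k : ℕ) := axisRot i (fiberDir a) (θ k) w
  have hy (k : ℕ) : ‖y k‖ = 1 := by rw [norm_axisRot i (norm_fiberDir a), hw]
  have hy0 : y 0 = w := by
    have : θ 0 = 0 := by cases b <;> simp [θ]
    simp only [y, this, axisRot, planeRot_zero]
  have hstep (k : ℕ) : rhoBall (y k).fst (y (k + 1)).fst ≤ r / 4 := by
    refine (rhoBall_fst_le (hy k) (hy (k + 1))).trans ?_
    have hθ : θ (k + 1) = cond b (r / 8) (-(r / 8)) + θ k := by
      cases b <;> simp only [θ, cond_true, cond_false] <;> push_cast <;> ring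
    have h1 : y (k + 1) = axisRot i (fiberDir a) (cond b (r / 8) (-(r / 8))) (y k) := by
      simp only [y, hθ]
      exact planeRot_add (norm_ballAxis i) (norm_fiberAxis (norm_fiberDir a))
        (inner_ballAxis_fiberAxis i _) _ _ w
    have h2 := norm_planeRot_sub_self_le (norm_ballAxis i) (norm_fiberAxis (norm_fiberDir a))
      (inner_ballAxis_fiberAxis i _) (cond b (r / 8) (-(r / 8))) (y k)
    rw [← axisRot, ← h1, hy, mul_one, norm_sub_rev] at h2
    have h3 : |cond b (r / 8) (-(r / 8))| = r / 8 := by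
      have : 0 ≤ r / 8 := by positivity
      cases b <;> simp only [cond_true, cond_false, abs_neg, abs_of_nonneg this]
    linarith
  have hex : ∃ k, r / 4 < rhoBall (ξ j) (y k).fst := by
    refine ⟨64 * d, ?_⟩
    have h1 := rhoBall_triangle w.fst (ξ j) (y (64 * d)).fst
    have h2 := hj.2
    rw [rhoBall_comm] at h2
    have h3 : r ≤ rhoBall w.fst (y (64 * d)).fst := hiab
    linarith
  classical
  have hk0 : Nat.find hex ≠ 0 := by
    intro h0
    have := Nat.find_spec hex
    rw [h0, hy0] at this
    exact this.not_ge hj.2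
  have hkK : Nat.find hex ≤ 64 * d := by
    refine Nat.find_min' hex ?_
    have h1 := rhoBall_triangle w.fst (ξ j) (y (64 * d)).fst
    have h2 := hj.2
    rw [rhoBall_comm] at h2
    have h3 : r ≤ rhoBall w.fst (y (64 * d)).fst := hiab
    linarith
  refine ⟨i, a, b, ⟨Nat.find hex, Nat.lt_succ_of_le hkK⟩, ?_⟩
  change (y (Nat.find hex)).fst ∉ _
  have hgt := Nat.find_spec hex
  obtain ⟨k, hk⟩ := Nat.exists_eq_succ_of_ne_zero hk0
  have hprev : rhoBall (ξ j) (y k).fst ≤ r / 4 := not_lt.1 (Nat.find_min hex (by omega))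
  rw [hk] at hgt ⊢
  rw [mem_iUnion]
  rintro ⟨l, hl⟩
  by_cases hlj : l = j
  · subst hlj
    exact hgt.not_ge hl.2
  · have h1 := hsep l j hlj
    have h2 := rhoBall_triangle (ξ l) (y (k + 1)).fst (ξ j)
    have h3 := rhoBall_triangle (y (k + 1)).fst (y k).fst (ξ j)
    rw [rhoBall_comm (y (k + 1)).fst (y k).fst, rhoBall_comm (y k).fst (ξ j)] at h3
    have h4 : rhoBall (ξ l) (y (k + 1)).fst ≤ r / 4 := hl.2
    have h5 := hstep k
    linarith

end BallGeometry

section Transfer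

variable {d : ℕ}

lemma isTrigPoly_comp_axisRot {n : ℕ} {f : EuclideanSpace ℝ (Fin d) → ℝ} (hf : IsPolyDeg n f)
    (i : Fin d) (u : ℂ) :
    IsTrigPoly n fun t w => (f (axisRot i u t w).fst : ℂ) := by
  obtain ⟨P, hP, hfP⟩ := hf
  simp only [hfP]
  refine IsTrigPoly.mvPolynomial_eval hP fun l => ?_
  by_cases hl : l = i
  · subst hl
    simp only [axisRot_fst_same, Complex.ofReal_add, Complex.ofReal_mul]
    have h1 : Continuous fun w : WithLp 2 (EuclideanSpace ℝ (Fin d) × ℂ) => (w.fst l : ℂ) := by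
      fun_prop
    have h2 : Continuous fun w : WithLp 2 (EuclideanSpace ℝ (Fin d) × ℂ) =>
        ((inner ℝ u w.snd : ℝ) : ℂ) := by
      fun_prop
    exact IsTrigPoly.cos_sin ⟨_, h1⟩ ⟨_, h2⟩
  · simp only [axisRot_fst_of_ne hl]
    have h1 : Continuous fun w : WithLp 2 (EuclideanSpace ℝ (Fin d) × ℂ) => (w.fst l : ℂ) := by
      fun_prop
    exact IsTrigPoly.const 1 ⟨_, h1⟩

lemma IsPolyDeg.continuous {n : ℕ} {f : EuclideanSpace ℝ (Fin d) → ℝ} (hf : IsPolyDeg n f) :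
    Continuous f := by
  obtain ⟨P, -, hfP⟩ := hf
  rw [funext hfP]
  exact (MvPolynomial.continuous_eval P).comp (by fun_prop)

/-- Norm inequalities for functions on the ball lifted to the sphere descend to the ball. -/
lemma eLpNorm_closedBall_le_of_coneMeasure {E : Type*} [NormedAddCommGroup E]
    [InnerProductSpace ℝ E] [FiniteDimensional ℝ E] [MeasurableSpace E] [BorelSpace E]
    [Nontrivial E] {p : ℝ≥0∞} (hp : p ≠ ∞) {f : E → ℝ} (hf : Continuous f) {A : Set E}
    (hA : MeasurableSet A) {K : ℝ≥0∞}
    (h : eLpNorm (fun w => f w.fst) p (coneMeasure (WithLp 2 (E × ℂ))) ≤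
      K * eLpNorm (((fun w => w.fst) ⁻¹' A)ᶜ.indicator fun w => f w.fst) p
        (coneMeasure (WithLp 2 (E × ℂ)))) :
    eLpNorm f p (volume.restrict (Metric.closedBall 0 1)) ≤
      K * eLpNorm f p (volume.restrict (Metric.closedBall 0 1 \ A)) := by
  obtain ⟨c, hc0, hct, hmap⟩ := exists_map_fst_coneMeasure (E := E)
  have hfst : AEMeasurable (fun w : WithLp 2 (E × ℂ) => w.fst) (coneMeasure (WithLp 2 (E × ℂ))) :=
    (by fun_prop : Continuous fun w : WithLp 2 (E × ℂ) => w.fst).aemeasurable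
  have hlift {g : E → ℝ} (hg : Measurable g) :
      eLpNorm (fun w => g w.fst) p (coneMeasure (WithLp 2 (E × ℂ))) =
        c ^ (1 / p).toReal * eLpNorm g p (volume.restrict (Metric.closedBall 0 1)) := by
    rw [← smul_eq_mul, ← eLpNorm_smul_measure_of_ne_top hp, ← hmap,
      eLpNorm_map_measure hg.aestronglyMeasurable hfst]
    rfl
  have hind : (((fun w : WithLp 2 (E × ℂ) => w.fst) ⁻¹' A)ᶜ.indicator fun w => f w.fst) =
      fun w => Aᶜ.indicator f w.fst := by
    ext w
    by_cases hw : w.fst ∈ A <;> simp [indicator, hw]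
  rw [hind, hlift hf.measurable, hlift (hf.measurable.indicator hA.compl),
    eLpNorm_indicator_eq_eLpNorm_restrict hA.compl, Measure.restrict_restrict hA.compl,
    inter_comm, ← sdiff_eq, mul_left_comm] at h
  refine (ENNReal.mul_le_mul_iff_right ?_ ?_).1 h
  · exact (ENNReal.rpow_pos (pos_iff_ne_zero.2 hc0) hct).ne'
  · exact ENNReal.rpow_ne_top_of_nonneg ENNReal.toReal_nonneg hct

end Transfer
/-- **Lemma 7.6**: removing small `ρ_B`-balls around a `(δ/n)`-separated set does not decrease
the `L^p`-norm of polynomials of degree `≤ n` on the unit ball by more than a constant factor. -/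
theorem Lp_norm_restriction_ball (d : ℕ) (hd : 1 ≤ d) :
    ∃ δ₀ : ℝ, 0 < δ₀ ∧ δ₀ < 1 ∧ ∃ C : ℝ, 0 < C ∧
      ∀ (n : ℕ), 0 < n → ∀ δ : ℝ, 0 < δ → δ < δ₀ →
      ∀ (m : ℕ) (ξ : Fin m → EuclideanSpace ℝ (Fin d)),
        (∀ i, ‖ξ i‖ ≤ 1) →
        (∀ i j, i ≠ j → δ / n ≤ rhoBall (ξ i) (ξ j)) →
        ∀ p : ℝ≥0∞, 1 ≤ p → p ≠ ∞ →
        ∀ f : EuclideanSpace ℝ (Fin d) → ℝ, IsPolyDeg n f →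
          eLpNorm f p (volume.restrict (Metric.closedBall 0 1))
            ≤ ENNReal.ofReal C *
              eLpNorm f p (volume.restrict
                (Metric.closedBall 0 1 \ ⋃ j, ballB (ξ j) (δ / (4 * n)))) := by
  have hD : (1 : ℝ) ≤ d := by exact_mod_cast hd
  have : Nonempty (Fin d) := ⟨⟨0, hd⟩⟩
  let ι := Fin d × Bool × Bool × Fin (64 * d + 1)
  let N : ℝ := Fintype.card ι
  have hN : 1 ≤ N := Nat.one_le_cast.2 (Fintype.card_pos (α := ι))
  refine ⟨1 / (112 * d ^ 2 * N), by positivity, ?_, 2 * (1 + N), by positivity, ?_⟩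
  · rw [div_lt_one (by positivity)]
    nlinarith [mul_le_mul hD hD zero_le_one (by positivity), mul_le_mul
      (one_le_pow₀ hD : 1 ≤ (d : ℝ) ^ 2) hN zero_le_one (by positivity)]
  intro n hn δ hδ0 hδ m ξ _ hsep p hp hp' f hf
  have hn1 : (1 : ℝ) ≤ n := by exact_mod_cast hn
  have hδN : δ * (112 * d * N) ≤ 1 := by
    rw [lt_div_iff₀ (by positivity)] at hδ
    refine le_trans ?_ hδ.le
    have : (d : ℝ) ≤ d ^ 2 := by nlinarith
    gcongr
  have hr : δ / n ≤ 1 / (32 * d ^ 2) := by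
    refine (div_le_self hδ0.le hn1).trans (hδ.le.trans ?_)
    refine one_div_le_one_div_of_le (by positivity) ?_
    nlinarith [mul_le_mul_of_nonneg_left hN (by positivity : (0 : ℝ) ≤ d ^ 2)]
  have hf' := hf.continuous
  have hA : MeasurableSet (⋃ j, ballB (ξ j) (δ / (4 * n))) :=
    .iUnion fun j => (isClosed_ballB _ _).measurableSet
  have hG : Continuous fun w : WithLp 2 (EuclideanSpace ℝ (Fin d) × ℂ) => f w.fst := by fun_prop
  have hfst : Measurable fun w : WithLp 2 (EuclideanSpace ℝ (Fin d) × ℂ) => w.fst :=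
    (by fun_prop : Continuous _).measurable
  let θ (j : ι) : ℝ := cond j.2.2.1 (j.2.2.2 * (δ / n / 8)) (-(j.2.2.2 * (δ / n / 8)))
  have hθ (j : ι) : |θ j| ≤ 8 * d * (δ / n) := by
    have h0 : 0 ≤ (j.2.2.2 : ℝ) * (δ / n / 8) := by positivity
    have h1 : |θ j| = j.2.2.2 * (δ / n / 8) := by
      rcases j with ⟨i, a, b, k⟩
      cases b <;> simp only [θ, cond_true, cond_false, abs_neg, abs_of_nonneg h0]
    have h2 : (j.2.2.2 : ℝ) ≤ 64 * d := by exact_mod_cast Nat.lt_succ_iff.1 j.2.2.2.2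
    rw [h1]
    calc (j.2.2.2 : ℝ) * (δ / n / 8) ≤ 64 * d * (δ / n / 8) := by gcongr
      _ = _ := by ring
  let T (j : ι) := axisRot j.1 (fiberDir j.2.1) (θ j)
  have key := eLpNorm_le_of_exists_notMem hp (memLp_coneMeasure_of_continuous hG p) (hfst hA)
    (T := fun j => T j) (ε := ENNReal.ofReal (56 * d * δ))
    (fun j => measurePreserving_coneMeasure (T j) (norm_axisRot _ (norm_fiberDir _) _))
    (by
      filter_upwards [ae_coneMeasure_norm_eq_one] with w hw hwA
      have h4 : δ / (4 * n) = δ / n / 4 := by rw [div_div, mul_comm]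
      rw [h4] at hwA ⊢
      obtain ⟨i, a, b, k, h⟩ := exists_axisRot_fst_notMem hd (by positivity) hr hsep hw hwA
      exact ⟨(i, a, b, k), h⟩)
    (fun j => by
      refine (eLpNorm_comp_sub_le hn hp hG (norm_axisRot j.1 (norm_fiberDir j.2.1))
        (planeRot_zero _ _) (isTrigPoly_comp_axisRot hf _ _) (θ j)).trans ?_
      refine mul_le_mul_left (ENNReal.ofReal_le_ofReal ?_) _
      calc 7 * n * |θ j| ≤ 7 * n * (8 * d * (δ / n)) := by gcongr; exact hθ j
        _ = 56 * d * δ := by field_simp; norm_num)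
    (by
      rw [← ENNReal.ofReal_natCast, ← ENNReal.ofReal_mul (by positivity), one_div,
        ← ENNReal.ofReal_ofNat, ← ENNReal.ofReal_inv_of_pos two_pos]
      refine ENNReal.ofReal_le_ofReal ?_
      change N * _ ≤ _
      linarith)
  have hC : ENNReal.ofReal (2 * (1 + N)) = 2 * (1 + Fintype.card ι) := by
    rw [ENNReal.ofReal_mul zero_le_two, ENNReal.ofReal_add zero_le_one (by positivity)]
    simp [N]
  rw [hC]
  exact eLpNorm_closedBall_le_of_coneMeasure hp' hf' hA key
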